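/- Let Λ = {A,B}, let G_A be the graph with a single node and a single A-labeled loop, and let G_B be the graph with a single node and a single B-labeled loop. Then there exists no Λ-labeled restriction graph R such that L_R(R) = L_R(G_A) ∩ L_R(G_B); i.e., restriction graph languages are not closed under intersection. -/

import Mathlib

/-- A `Λ`-labeled graph: finite sets of nodes and edges, with source/target maps
and an edge labeling. -/
structure LGraph (Λ : Type) : Type 1 where
  V : Type
  E : Type
  finV : Finite V
  finE : Finite E
  src : E → V
  tgt : E → V
  lab : E → Λ

/-- A morphism of `Λ`-labeled graphs: maps on nodes and edges commuting with
source and target and preserving labels. -/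
structure LGraph.Hom {Λ : Type} (G H : LGraph Λ) : Type where
  fV : G.V → H.V
  fE : G.E → H.E
  src_comm : ∀ e, H.src (fE e) = fV (G.src e)
  tgt_comm : ∀ e, H.tgt (fE e) = fV (G.tgt e)
  lab_comm : ∀ e, H.lab (fE e) = G.lab e

/-- Composition of graph morphisms. -/
def LGraph.Hom.comp {Λ : Type} {G H K : LGraph Λ} (ψ : LGraph.Hom H K)
    (φ : LGraph.Hom G H) : LGraph.Hom G K where
  fV := ψ.fV ∘ φ.fV
  fE := ψ.fE ∘ φ.fE
  src_comm e := by simp [Function.comp_apply, ψ.src_comm, φ.src_comm]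
  tgt_comm e := by simp [Function.comp_apply, ψ.tgt_comm, φ.tgt_comm]
  lab_comm e := by simp [Function.comp_apply, ψ.lab_comm, φ.lab_comm]

/-- `G → H`: there exists some graph morphism from `G` to `H`. -/
def LGraph.Arrow {Λ : Type} (G H : LGraph Λ) : Prop := Nonempty (LGraph.Hom G H)

/-- The type graph language `L(T) = {G | G → T}`. -/
def TGLang {Λ : Type} (T : LGraph Λ) : Set (LGraph Λ) := {G | LGraph.Arrow G T}

/-- The restriction graph language `L_R(R) = {G | R ↛ G}`. -/
def RGLang {Λ : Type} (R : LGraph Λ) : Set (LGraph Λ) := {G | ¬ LGraph.Arrow R G}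

/-- The two-element label set `Λ = {A, B}`. -/
inductive Lab : Type
  | A
  | B
deriving DecidableEq

/-- The graph with a single node and a single `l`-labeled loop. -/
def loopGraph (l : Lab) : LGraph Lab where
  V := Unit
  E := Unit
  finV := inferInstance
  finE := inferInstance
  src _ := ()
  tgt _ := ()
  lab _ := l

/-- There is no restriction graph `R` whose language is `L_R(G_A) ∩ L_R(G_B)`:
restriction graph languages are not closed under intersection. -/
theorem restrictionGraphLang_not_closed_inter :
    ¬ ∃ R : LGraph Lab, RGLang R = RGLang (loopGraph Lab.A) ∩ RGLang (loopGraph Lab.B) := by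
  rintro ⟨R, hR⟩
  have key : ∀ G : LGraph Lab, LGraph.Arrow R G ↔
      (LGraph.Arrow (loopGraph Lab.A) G ∨ LGraph.Arrow (loopGraph Lab.B) G) := by
    intro G
    have h : G ∈ RGLang R ↔ G ∈ RGLang (loopGraph Lab.A) ∩ RGLang (loopGraph Lab.B) := by
      rw [hR]
    simp only [RGLang, Set.mem_inter_iff, Set.mem_setOf_eq] at h
    tauto
  have refl : ∀ G : LGraph Lab, LGraph.Arrow G G := fun G =>
    ⟨⟨id, id, fun _ => rfl, fun _ => rfl, fun _ => rfl⟩⟩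
  rcases (key R).1 (refl R) with ⟨⟨f⟩⟩ | ⟨⟨f⟩⟩
  · obtain ⟨g⟩ := (key (loopGraph Lab.B)).2 (Or.inr (refl _))
    have h := (g.comp f).lab_comm ()
    simp [loopGraph] at h
  · obtain ⟨g⟩ := (key (loopGraph Lab.A)).2 (Or.inl (refl _))
    have h := (g.comp f).lab_comm ()
    simp [loopGraph] at h
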